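/- arXiv:2111.04906 — 2 statements merged into one kernel-verified Lean document; each statement's English description precedes it below -/
import Mathlib

section
/- Let E be a real Hilbert space, S ⊆ E a nonempty closed convex set with metric projection Π_S, and f : E → ℝ convex and differentiable. Fix x ∈ S and a minimizer-candidate point x* ∈ S, let g = ∇f(x) satisfy ‖g‖ ≤ C for some C > 0, and let α ≥ 0 and σ ≥ 0. Let z be an E-valued random vector on a probability space that is integrable with E[z] = 0 and with ‖z‖² integrable and E[‖z‖²] ≤ σ²C². Then E[ ‖Π_S(x − α·(g + z)) − x*‖² ] ≤ ‖x − x*‖² − 2α·(f(x) − f(x*)) + α²·C²·(1 + σ²). -/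
open MeasureTheory

/-- Single-step descent inequality from the proof of the paper's DPSGD convergence
theorem (Theorem 2): for a convex differentiable `f` with gradient `g = ∇f(x)`,
`‖g‖ ≤ C`, a nonexpansive metric projection `Π_S` onto a nonempty closed convex `S`,
and zero-mean noise `z` with `E[‖z‖²] ≤ σ²C²`,
`E[‖Π_S(x - α(g + z)) - x*‖²] ≤ ‖x - x*‖² - 2α(f(x) - f(x*)) + α²C²(1 + σ²)`. -/
theorem stmt1 {E : Type*} [NormedAddCommGroup E] [InnerProductSpace ℝ E] [CompleteSpace E]
    (S : Set E) (hSne : S.Nonempty) (hScl : IsClosed S) (hSconv : Convex ℝ S)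
    (proj : E → E)
    (hproj : ∀ y : E, proj y ∈ S ∧ ∀ w ∈ S, ‖y - proj y‖ ≤ ‖y - w‖)
    (f : E → ℝ) (hf : ConvexOn ℝ Set.univ f) (hfd : Differentiable ℝ f)
    (x : E) (hx : x ∈ S) (xstar : E) (hxstar : xstar ∈ S)
    (g : E) (hg : HasGradientAt f g x)
    (C : ℝ) (hC : 0 < C) (hgC : ‖g‖ ≤ C)
    (α : ℝ) (hα : 0 ≤ α) (σ : ℝ) (hσ : 0 ≤ σ)
    {Ω : Type*} [MeasurableSpace Ω] (μ : Measure Ω) [IsProbabilityMeasure μ]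
    (z : Ω → E)
    (hzint : Integrable z μ) (hzmean : ∫ ω, z ω ∂μ = 0)
    (hz2int : Integrable (fun ω => ‖z ω‖ ^ 2) μ)
    (hzvar : (∫ ω, ‖z ω‖ ^ 2 ∂μ) ≤ σ ^ 2 * C ^ 2) :
    (∫ ω, ‖proj (x - α • (g + z ω)) - xstar‖ ^ 2 ∂μ) ≤
      ‖x - xstar‖ ^ 2 - 2 * α * (f x - f xstar) + α ^ 2 * C ^ 2 * (1 + σ ^ 2) := by
  -- variational characterisation of the projection
  have hvar : ∀ y : E, inner ℝ (y - proj y) (xstar - proj y) ≤ 0 := by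
    intro y
    have : Nonempty S := ⟨⟨x, hx⟩⟩
    refine (norm_eq_iInf_iff_real_inner_le_zero hSconv (hproj y).1).1 ?_ xstar hxstar
    apply le_antisymm
    · exact le_ciInf fun w => (hproj y).2 w w.2
    · exact ciInf_le (f := fun w : S => ‖y - w‖)
        ⟨0, by rintro _ ⟨w, rfl⟩; exact norm_nonneg _⟩ ⟨proj y, (hproj y).1⟩
  have hdist : ∀ y : E, ‖proj y - xstar‖ ^ 2 ≤ ‖y - xstar‖ ^ 2 := by
    intro y
    have h := hvar y
    have e : y - xstar = (y - proj y) - (xstar - proj y) := by abel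
    have e2 : ‖proj y - xstar‖ = ‖xstar - proj y‖ := norm_sub_rev _ _
    rw [e2, e, norm_sub_sq_real (y - proj y)]
    nlinarith [sq_nonneg ‖y - proj y‖]
  -- first-order convexity inequality
  have hconv : f x - f xstar ≤ inner ℝ (x - xstar) g := by
    have hc : ConvexOn ℝ Set.univ (fun t : ℝ => f (AffineMap.lineMap x xstar t)) := by
      exact hf.comp_affineMap (AffineMap.lineMap x xstar : ℝ →ᵃ[ℝ] E)
    have hd : HasDerivAt (fun t : ℝ => f (AffineMap.lineMap x xstar t))
        (inner ℝ g (xstar - x)) 0 := by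
      have h1 : HasFDerivAt f (InnerProductSpace.toDual ℝ E g)
          (AffineMap.lineMap x xstar (0 : ℝ)) := by
        simpa using hg.hasFDerivAt
      have h2 : HasDerivAt (fun t : ℝ => (AffineMap.lineMap x xstar t : E)) (xstar - x) 0 :=
        AffineMap.hasDerivAt_lineMap
      exact h1.comp_hasDerivAt (0 : ℝ) h2
    have h := hc.le_slope_of_hasDerivAt (Set.mem_univ 0) (Set.mem_univ 1) zero_lt_one hd
    simp [slope_def_field] at h
    have e : (inner ℝ g (xstar - x) : ℝ) = - inner ℝ (x - xstar) g := by
      rw [← neg_sub x xstar, inner_neg_right, real_inner_comm]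
    linarith
  -- pointwise expansion
  set v : E := (2 * α ^ 2) • g - (2 * α) • (x - xstar) with hv
  set K : ℝ := ‖x - xstar‖ ^ 2 - 2 * α * inner ℝ (x - xstar) g + α ^ 2 * ‖g‖ ^ 2 with hK
  have hpt : ∀ ω, ‖proj (x - α • (g + z ω)) - xstar‖ ^ 2 ≤
      K + (inner ℝ v (z ω) + α ^ 2 * ‖z ω‖ ^ 2) := by
    intro ω
    refine (hdist _).trans (le_of_eq ?_)
    have e : x - α • (g + z ω) - xstar = (x - xstar) - α • (g + z ω) := by abel
    rw [e, norm_sub_sq_real, norm_smul, mul_pow, norm_add_sq_real, real_inner_smul_right,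
      inner_add_right, hv, inner_sub_left (_ • g), real_inner_smul_left, real_inner_smul_left,
      Real.norm_eq_abs, sq_abs, hK]
    ring
  have hi1 : Integrable (fun ω => (inner ℝ v (z ω) : ℝ)) μ := hzint.const_inner v
  have hi2 : Integrable (fun ω => α ^ 2 * ‖z ω‖ ^ 2) μ := hz2int.const_mul _
  have hi12 : Integrable (fun ω => (inner ℝ v (z ω) : ℝ) + α ^ 2 * ‖z ω‖ ^ 2) μ := hi1.add hi2
  have h0 : ∫ ω, (inner ℝ v (z ω) : ℝ) ∂μ = 0 := by
    rw [integral_inner hzint v, hzmean, inner_zero_right]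
  have hmono := integral_mono_of_nonneg (μ := μ)
    (Filter.Eventually.of_forall fun ω => sq_nonneg ‖proj (x - α • (g + z ω)) - xstar‖)
    ((integrable_const K).add hi12) (Filter.Eventually.of_forall hpt)
  have hval : ∫ ω, (K + ((inner ℝ v (z ω) : ℝ) + α ^ 2 * ‖z ω‖ ^ 2)) ∂μ
      = K + α ^ 2 * ∫ ω, ‖z ω‖ ^ 2 ∂μ := by
    rw [integral_add (integrable_const K) hi12, integral_add hi1 hi2, h0, integral_const_mul]
    simp
  refine hmono.trans ?_
  refine hval.le.trans ?_
  rw [hK]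
  have a1 : α ^ 2 * ∫ ω, ‖z ω‖ ^ 2 ∂μ ≤ α ^ 2 * (σ ^ 2 * C ^ 2) :=
    mul_le_mul_of_nonneg_left hzvar (sq_nonneg _)
  have a2 : α ^ 2 * ‖g‖ ^ 2 ≤ α ^ 2 * C ^ 2 :=
    mul_le_mul_of_nonneg_left (pow_le_pow_left₀ (norm_nonneg _) hgC 2) (sq_nonneg _)
  have a3 : 2 * α * (f x - f xstar) ≤ 2 * α * inner ℝ (x - xstar) g :=
    mul_le_mul_of_nonneg_left hconv (by linarith)
  linarith
end

section
/- Fix a type X of records and model datasets as multisets over X, with two datasets D, D′ adjacent if D′ is obtained from D by replacing a single element (i.e., there exist a ∈ D and b with D′ = (D \ {a}) + {b}). Fix γ ∈ (0,1], δ₂ > 0, ε₁ ≥ 0, δ₁ ≥ 0, and set Υ = ⌈(1/γ)·log(1/δ₂)⌉. Let (Y, 𝒴) be a measurable space of candidates and for each dataset D let Q(D) be a probability measure on Y × ℝ (a candidate together with its score) such that Q is (ε₁, δ₁)-differentially private: for all adjacent D, D′ and all measurable A ⊆ Y × ℝ, Q(D)(A) ≤ e^{ε₁}·Q(D′)(A)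 + δ₁. Define the LT mechanism LT(D) as the probability measure on Y obtained as follows: draw J with law ℙ[J = j] = γ(1−γ)^{j−1} for 1 ≤ j < Υ and ℙ[J = Υ] = (1−γ)^{Υ−1}; independently draw (x₁,q₁), …, (x_Υ, q_Υ) i.i.d. from Q(D); output x_{i*} where i* is the smallest index i ≤ J maximizing q_i among q₁, …, q_J. Then LT is (ε_f, δ_f)-differentially private with ε_f = 3ε₁ + 3√(2δ₁) and δ_f = √(2δ₁)·Υ + δ₂: for all adjacent D, D′ and all measurable B ⊆ Y, LT(D)(B) ≤ e^{ε_f}·LT(D′)(B) + δ_f. -/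
open MeasureTheory

/-- Two multiset datasets are adjacent if one is obtained from the other by replacing a
single element. -/
def Adjacent {X : Type*} (D D' : Multiset X) : Prop :=
  ∃ (a b : X) (D₀ : Multiset X), D = a ::ₘ D₀ ∧ D' = b ::ₘ D₀

/-- The smallest index `i < j` maximizing `q i` among `q 0, …, q (j-1)` (and `0` if
`j = 0`). -/
noncomputable def argmaxIdx (q : ℕ → ℝ) (j : ℕ) : ℕ := by
  classical
  exact ((Finset.range j).filter fun i => ∀ k ∈ Finset.range j, q k ≤ q i).min.getD 0

/-- The output of the LT algorithm given the `Υ` pre-drawn (candidate, score) pairs and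
the value `j` of the stopping time: the candidate with the highest score among the first
`j` draws (smallest index in case of ties). -/
noncomputable def ltOutput {Y : Type*} [Nonempty Y] (Υ : ℕ)
    (p : (Fin Υ → Y × ℝ) × ℕ) : Y :=
  let q : ℕ → ℝ := fun i => if h : i < Υ then (p.1 ⟨i, h⟩).2 else 0
  let i := argmaxIdx q (min p.2 Υ)
  if h : i < Υ then (p.1 ⟨i, h⟩).1 else Classical.arbitrary Y

/-- The law of the stopping time `J` of the LT algorithm:
`ℙ[J = j] = γ(1-γ)^(j-1)` for `1 ≤ j < Υ` and `ℙ[J = Υ] = (1-γ)^(Υ-1)`. -/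
noncomputable def stopLaw (γ : ℝ) (Υ : ℕ) : Measure ℕ :=
  ∑ j ∈ Finset.Icc 1 Υ,
    (ENNReal.ofReal (if j < Υ then γ * (1 - γ) ^ (j - 1) else (1 - γ) ^ (Υ - 1))) •
      Measure.dirac j

/-- The LT mechanism: draw the stopping time `J` from `stopLaw γ Υ` and, independently,
`Υ` i.i.d. (candidate, score) pairs from `Q D`; output the highest-scored candidate among
the first `J` draws. -/
noncomputable def ltMechanism {X Y : Type*} [MeasurableSpace Y] [Nonempty Y]
    (γ : ℝ) (Υ : ℕ) (Q : Multiset X → Measure (Y × ℝ)) (D : Multiset X) : Measure Y :=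
  Measure.map (ltOutput Υ) ((Measure.pi fun _ : Fin Υ => Q D).prod (stopLaw γ Υ))

/-- truncated double geometric series -/
noncomputable def gSer (T : ℕ) (u v : ℝ) : ℝ :=
  ∑ j ∈ Finset.range T, ∑ i ∈ Finset.range (j + 1), u ^ i * v ^ (j - i)

lemma gSer_comm (T : ℕ) (u v : ℝ) : gSer T u v = gSer T v u := by
  unfold gSer
  refine Finset.sum_congr rfl fun j _ => ?_
  rw [← Finset.sum_range_reflect]
  refine Finset.sum_congr rfl fun i hi => ?_
  have : i ≤ j := by simpa [Nat.lt_succ_iff] using hi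
  rw [mul_comm]
  congr 2
  omega

lemma gSer_succ (T : ℕ) (u v : ℝ) :
    gSer (T + 1) u v = (∑ j ∈ Finset.range (T + 1), u ^ j) + v * gSer T u v := by
  induction T with
  | zero => simp [gSer]
  | succ T ih =>
    have h1 : gSer (T + 1 + 1) u v = gSer (T + 1) u v
        + ∑ i ∈ Finset.range (T + 1 + 1), u ^ i * v ^ (T + 1 - i) := by
      simp only [gSer]; rw [Finset.sum_range_succ]
    have h2 : gSer (T + 1) u v = gSer T u v
        + ∑ i ∈ Finset.range (T + 1), u ^ i * v ^ (T - i) := by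
      simp only [gSer]; rw [Finset.sum_range_succ]
    have h3 : ∑ i ∈ Finset.range (T + 1 + 1), u ^ i * v ^ (T + 1 - i)
        = u ^ (T + 1) + v * ∑ i ∈ Finset.range (T + 1), u ^ i * v ^ (T - i) := by
      rw [Finset.sum_range_succ, Finset.mul_sum]
      simp only [Nat.sub_self, pow_zero, mul_one]
      rw [add_comm]
      congr 1
      refine Finset.sum_congr rfl fun i hi => ?_
      have : i ≤ T := by simpa [Nat.lt_succ_iff] using hi
      rw [Nat.succ_sub this, pow_succ]; ring
    rw [h1, h3, Finset.sum_range_succ (fun j => u ^ j) (T + 1)]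
    nth_rewrite 1 [ih]
    rw [h2]
    ring

lemma gSer_nonneg (T : ℕ) {u v : ℝ} (hu : 0 ≤ u) (hv : 0 ≤ v) : 0 ≤ gSer T u v := by
  unfold gSer; positivity

lemma gSer_mono (T : ℕ) {u u' v : ℝ} (hu : 0 ≤ u) (hv : 0 ≤ v) (h : u ≤ u') :
    gSer T u v ≤ gSer T u' v := by
  unfold gSer; gcongr

lemma gSer_anti (T : ℕ) {u u' v : ℝ} (hu : 0 ≤ u) (hv : 0 ≤ v) (h : u ≤ u') :
    (1 - u') * gSer T u' v ≤ (1 - u) * gSer T u v := by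
  induction T with
  | zero => simp [gSer]
  | succ T ih =>
    rw [gSer_succ, gSer_succ, mul_add, mul_add, mul_neg_geom_sum, mul_neg_geom_sum]
    have h1 : u ^ (T + 1) ≤ u' ^ (T + 1) := by gcongr
    have h2 := mul_le_mul_of_nonneg_left ih hv
    nlinarith

lemma gSer_ratio (T : ℕ) {u u' v c : ℝ} (hu : 0 ≤ u) (hu' : 0 ≤ u') (hv : 0 ≤ v)
    (hu1 : u < 1) (hc : 1 ≤ c) (h : 1 - u' ≤ c * (1 - u)) :
    gSer T u v ≤ c * gSer T u' v := by
  have h0 := gSer_nonneg T hu' hv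
  rcases le_total u u' with h1 | h1
  · have := gSer_mono T hu hv h1
    nlinarith
  · have h2 := gSer_anti T hu' hv h1
    have h3 := mul_le_mul_of_nonneg_right h h0
    have h4 : (1 - u) * gSer T u v ≤ (1 - u) * (c * gSer T u' v) := by linarith
    exact le_of_mul_le_mul_left h4 (by linarith)

lemma gSer_ratio2 (T : ℕ) {u u' v v' c : ℝ} (hu : 0 ≤ u) (hu' : 0 ≤ u') (hv : 0 ≤ v)
    (hv' : 0 ≤ v')
    (hu1 : u < 1) (hv1 : v < 1) (hc : 1 ≤ c) (h : 1 - u' ≤ c * (1 - u))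
    (h' : 1 - v' ≤ c * (1 - v)) :
    gSer T u v ≤ c * (c * gSer T u' v') := by
  refine (gSer_ratio T hu hu' hv hu1 hc h).trans ?_
  refine mul_le_mul_of_nonneg_left ?_ (by linarith)
  rw [gSer_comm T u' v, gSer_comm T u' v']
  exact gSer_ratio T hv hv' hu' hv1 hc h'

lemma gSer_bound (T : ℕ) {γ u v : ℝ} (hγ : γ ∈ Set.Ioc (0 : ℝ) 1) (hu : 0 ≤ u) (hv : 0 ≤ v)
    (hu1 : u ≤ 1 - γ) (hv1 : v ≤ 1 - γ) : γ * gSer T u v ≤ T := by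
  obtain ⟨h0, h1⟩ := hγ
  have h2 := gSer_anti T hu hv hu1
  have h3 : ∀ T : ℕ, γ * gSer T (1 - γ) v ≤ T := by
    intro T
    have h5 : gSer T (1 - γ) v ≤ gSer T (1 - γ) (1 - γ) := by
      rw [gSer_comm T _ v]
      exact gSer_mono T hv (by linarith) hv1
    induction T with
    | zero => simp [gSer]
    | succ T ih =>
      have h6 : gSer T (1 - γ) v ≤ gSer T (1 - γ) (1 - γ) := by
        rw [gSer_comm T _ v]
        exact gSer_mono T hv (by linarith) hv1
      have h7 := mul_neg_geom_sum (1 - γ) (T + 1)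
      have h8 : (0:ℝ) ≤ (1 - γ) ^ (T + 1) := pow_nonneg (by linarith) _
      have h9 := gSer_nonneg T (u := 1 - γ) (by linarith) hv
      rw [gSer_succ]; push_cast
      have h10 : v * (γ * gSer T (1 - γ) v) ≤ 1 * (γ * gSer T (1 - γ) v) :=
        mul_le_mul_of_nonneg_right (by linarith) (by positivity)
      have := ih h6
      nlinarith
  have := gSer_mono T hu hv hu1
  exact (mul_le_mul_of_nonneg_left this h0.le).trans (h3 T)

/-- DP for bounded functions -/
lemma dp_lintegral {Z : Type*} [MeasurableSpace Z] (P P' : Measure Z) (c d : ENNReal)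
    (h : ∀ A, MeasurableSet A → P A ≤ c * P' A + d) (C : ℝ)
    (f : Z → ℝ) (hf : Measurable f) (h0 : ∀ z, 0 ≤ f z) (h1 : ∀ z, f z ≤ C) :
    ∫⁻ z, ENNReal.ofReal (f z) ∂P ≤ c * ∫⁻ z, ENNReal.ofReal (f z) ∂P' + d * ENNReal.ofReal C := by
  rw [lintegral_eq_lintegral_meas_lt P (Filter.Eventually.of_forall h0) hf.aemeasurable,
    lintegral_eq_lintegral_meas_lt P' (Filter.Eventually.of_forall h0) hf.aemeasurable]
  have hm : Measurable fun t : ℝ => P' {a | t < f a} := by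
    apply Antitone.measurable
    intro s t hst
    exact measure_mono fun a (ha : t < f a) => lt_of_le_of_lt hst ha
  calc ∫⁻ t in Set.Ioi (0:ℝ), P {a | t < f a}
      ≤ ∫⁻ t in Set.Ioi (0:ℝ), (c * P' {a | t < f a} + (Set.Iio C).indicator (fun _ => d) t) := by
        refine lintegral_mono fun t => ?_
        by_cases ht : t < C
        · simp only [Set.indicator, Set.mem_Iio, ht, if_true]
          exact h _ (measurableSet_lt measurable_const hf)
        · have : {a | t < f a} = ∅ := by
            ext a; simp; linarith [h1 a, not_lt.1 ht]
          rw [this]; simp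
    _ = c * (∫⁻ t in Set.Ioi (0:ℝ), P' {a | t < f a}) + d * ENNReal.ofReal C := by
        rw [lintegral_add_left (hm.const_mul c), lintegral_const_mul c hm,
          lintegral_indicator measurableSet_Iio, lintegral_const,
          Measure.restrict_restrict measurableSet_Iio, Set.inter_comm, Set.Ioi_inter_Iio]
        simp

lemma argmaxIdx_lt (q : ℕ → ℝ) {j : ℕ} (hj : 0 < j) : argmaxIdx q j < j ∧
    (∀ k < j, q k ≤ q (argmaxIdx q j)) ∧ ∀ k < argmaxIdx q j, q k < q (argmaxIdx q j) := by
  classical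
  set S := (Finset.range j).filter fun i => ∀ k ∈ Finset.range j, q k ≤ q i with hS
  have hne : S.Nonempty := by
    obtain ⟨i, hi, h⟩ := Finset.exists_max_image (Finset.range j) q ⟨0, by simpa using hj⟩
    exact ⟨i, by simp only [hS, Finset.mem_filter]; exact ⟨hi, h⟩⟩
  obtain ⟨m, hm⟩ := Finset.min_of_nonempty hne
  have he : argmaxIdx q j = m := by
    have h1 : argmaxIdx q j = S.min.getD 0 := by
      unfold argmaxIdx
      rw [hS]
    rw [h1, hm]; rfl
  have hmem := Finset.mem_of_min hm
  simp only [hS, Finset.mem_filter, Finset.mem_range] at hmem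
  rw [he]
  refine ⟨hmem.1, hmem.2, fun k hk => ?_⟩
  refine lt_of_le_of_ne (hmem.2 k (by omega)) fun hkm => ?_
  have : k ∈ S := by
    simp only [hS, Finset.mem_filter, Finset.mem_range]
    exact ⟨by omega, fun l hl => hkm ▸ hmem.2 l hl⟩
  have := Finset.min_le_of_eq this hm
  omega

lemma argmaxIdx_eq_iff (q : ℕ → ℝ) {j i : ℕ} (hi : i < j) : argmaxIdx q j = i ↔
    (∀ k < j, q k ≤ q i) ∧ ∀ k < i, q k < q i := by
  obtain ⟨h1, h2, h3⟩ := argmaxIdx_lt q (j := j) (by omega)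
  constructor
  · rintro rfl; exact ⟨h2, h3⟩
  · rintro ⟨h4, h5⟩
    rcases lt_trichotomy (argmaxIdx q j) i with h | h | h
    · exact absurd (h5 _ h) (not_lt.2 (h2 i hi))
    · exact h
    · exact absurd (h3 _ h) (not_lt.2 (h4 _ h1))

/-- Event that draw `i` wins among the first `j`, with candidate in `B`. -/
def winSet {Y : Type*} (n j : ℕ) (i : Fin (n + 1)) (B : Set Y) : Set (Fin (n + 1) → Y × ℝ) :=
  {x | (x i).1 ∈ B ∧ ∀ k : Fin (n + 1), (k.1 < i.1 → (x k).2 < (x i).2) ∧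
    (k.1 < j → (x k).2 ≤ (x i).2)}

lemma measurableSet_winSet {Y : Type*} [MeasurableSpace Y] (n j : ℕ) (i : Fin (n + 1))
    {B : Set Y} (hB : MeasurableSet B) : MeasurableSet (winSet n j i B) := by
  unfold winSet
  have hc : ∀ k : Fin (n + 1), Measurable fun x : Fin (n + 1) → Y × ℝ => (x k).2 :=
    fun k => measurable_snd.comp (measurable_pi_apply k)
  refine MeasurableSet.inter ((measurable_fst.comp (measurable_pi_apply i)) hB) ?_
  change MeasurableSet {x : Fin (n + 1) → Y × ℝ | ∀ k : Fin (n + 1),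
    (k.1 < i.1 → (x k).2 < (x i).2) ∧ (k.1 < j → (x k).2 ≤ (x i).2)}
  rw [Set.ofPred_forall]
  refine MeasurableSet.iInter fun k => ?_
  rw [Set.ofPred_and]
  refine MeasurableSet.inter ?_ ?_
  · by_cases h : k.1 < i.1
    · simp only [h, true_imp_iff]; exact measurableSet_lt (hc k) (hc i)
    · simp [h]
  · by_cases h : k.1 < j
    · simp only [h, true_imp_iff]; exact measurableSet_le (hc k) (hc i)
    · simp [h]

lemma ltOutput_mem_iff {Y : Type*} [Nonempty Y] (n j : ℕ) (hj : 0 < j) (hjn : j ≤ n + 1)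
    (B : Set Y) (x : Fin (n + 1) → Y × ℝ) :
    ltOutput (n + 1) (x, j) ∈ B ↔ ∃ i : Fin (n + 1), i.1 < j ∧ x ∈ winSet n j i B := by
  set q : ℕ → ℝ := fun i => if h : i < n + 1 then (x ⟨i, h⟩).2 else 0 with hq
  have hqk : ∀ k : Fin (n + 1), q k.1 = (x k).2 := fun k => by simp only [hq]; rw [dif_pos k.2]
  have hlt := (argmaxIdx_lt q hj).1
  have hlt' : argmaxIdx q j < n + 1 := by omega
  have hout : ltOutput (n + 1) (x, j) = (x ⟨argmaxIdx q j, hlt'⟩).1 := by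
    have : min j (n + 1) = j := min_eq_left hjn
    simp only [ltOutput, this]
    rw [dif_pos hlt']
  have hwin : ∀ i : Fin (n + 1), i.1 < j → (x ∈ winSet n j i B ↔
      (x i).1 ∈ B ∧ argmaxIdx q j = i.1) := by
    intro i hi
    rw [argmaxIdx_eq_iff q hi, winSet, Set.mem_ofPred_eq]
    refine and_congr_right fun _ => ?_
    rw [hqk i]
    constructor
    · intro h
      exact ⟨fun k hk => by simpa [← hqk] using (h ⟨k, by omega⟩).2 hk,
        fun k hk => by simpa [← hqk] using (h ⟨k, by omega⟩).1 hk⟩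
    · rintro ⟨h1, h2⟩ k
      rw [← hqk k]
      exact ⟨fun h => h2 k h, fun h => h1 k h⟩
  rw [hout]
  constructor
  · intro h
    exact ⟨⟨_, hlt'⟩, hlt, (hwin ⟨_, hlt'⟩ hlt).2 ⟨h, rfl⟩⟩
  · rintro ⟨i, hi, hx⟩
    obtain ⟨h1, h2⟩ := (hwin i hi).1 hx
    have : i = ⟨argmaxIdx q j, hlt'⟩ := Fin.ext h2.symm
    rwa [← this]

lemma winSet_disjoint {Y : Type*} (n j : ℕ) (B : Set Y) (i i' : Fin (n + 1))
    (hi : i.1 < j) (hi' : i'.1 < j) (h : i ≠ i') : Disjoint (winSet n j i B) (winSet n j i' B) := by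
  rw [Set.disjoint_left]
  rintro x ⟨_, h1⟩ ⟨_, h2⟩
  rcases lt_or_gt_of_ne h with h | h
  · exact absurd ((h2 i).1 h) (not_lt.2 ((h1 i').2 hi'))
  · exact absurd ((h1 i').1 h) (not_lt.2 ((h2 i).2 hi))

lemma measurable_ltOutput {Y : Type*} [MeasurableSpace Y] [Nonempty Y] (n : ℕ) :
    Measurable (ltOutput (Y := Y) (n + 1)) := by
  have key : ∀ j : ℕ, 0 < j → j ≤ n + 1 →
      Measurable fun x : Fin (n + 1) → Y × ℝ => ltOutput (n + 1) (x, j) := by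
    intro j h1 h2 B hB
    have : (fun x : Fin (n + 1) → Y × ℝ => ltOutput (n + 1) (x, j)) ⁻¹' B =
        ⋃ i : Fin (n + 1), ⋃ _ : i.1 < j, winSet n j i B := by
      ext x
      simp only [Set.mem_preimage, Set.mem_iUnion, ltOutput_mem_iff n j h1 h2 B x, exists_prop]
    rw [this]
    exact MeasurableSet.iUnion fun i => MeasurableSet.iUnion fun _ => measurableSet_winSet n j i hB
  refine measurable_from_prod_countable_left fun j => ?_
  rcases Nat.eq_zero_or_pos j with rfl | h1
  · have : (fun x : Fin (n + 1) → Y × ℝ => ltOutput (n + 1) (x, 0)) = fun x => (x 0).1 := by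
      funext x
      have h0 : ∀ q, argmaxIdx q 0 = 0 := fun q => by simp [argmaxIdx]; rfl
      simp [ltOutput, h0]
    rw [this]
    exact measurable_fst.comp (measurable_pi_apply 0)
  · rcases le_total j (n + 1) with h2 | h2
    · exact key j h1 h2
    · have : (fun x : Fin (n + 1) → Y × ℝ => ltOutput (n + 1) (x, j)) =
          fun x => ltOutput (n + 1) (x, n + 1) := by
        funext x
        simp [ltOutput, h2]
      rw [this]
      exact key _ (by omega) le_rfl

lemma prod_aux (n i j : ℕ) (hi : i < j) (hj : j ≤ n + 1) (a b : ENNReal) :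
    ∏ k ∈ Finset.range (n + 1), (if k < i then a else if k = i then 1 else if k < j then b else 1)
      = a ^ i * b ^ (j - 1 - i) := by
  obtain ⟨d, rfl⟩ : ∃ d, j = i + 1 + d := ⟨j - (i + 1), by omega⟩
  obtain ⟨f, hf⟩ : ∃ f, n + 1 = i + 1 + d + f := ⟨n + 1 - (i + 1 + d), by omega⟩
  rw [hf, Finset.prod_range_add, Finset.prod_range_add, Finset.prod_range_succ]
  have e1 : ∏ k ∈ Finset.range i, (if k < i then a else
      if k = i then 1 else if k < i + 1 + d then b else 1) = a ^ i := by
    rw [Finset.prod_congr rfl (g := fun _ => a) fun k hk => if_pos (Finset.mem_range.1 hk)]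
    simp
  have e2 : ∏ k ∈ Finset.range d, (if i + 1 + k < i then a else
      if i + 1 + k = i then 1 else if i + 1 + k < i + 1 + d then b else 1) = b ^ d := by
    rw [Finset.prod_congr rfl (g := fun _ => b) fun k hk => ?_]
    · simp
    · have := Finset.mem_range.1 hk
      rw [if_neg (by omega), if_neg (by omega), if_pos (by omega)]
  have e3 : ∏ k ∈ Finset.range f, (if i + 1 + d + k < i then a else
      if i + 1 + d + k = i then 1 else if i + 1 + d + k < i + 1 + d then b else 1)
        = 1 := by
    refine Finset.prod_eq_one fun k hk => ?_
    rw [if_neg (by omega), if_neg (by omega), if_neg (by omega)]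
  rw [e1, e2, e3]
  have : i + 1 + d - 1 - i = d := by omega
  simp [this]

lemma pi_winSet {Y : Type*} [MeasurableSpace Y] (P : Measure (Y × ℝ)) [IsProbabilityMeasure P]
    (n j : ℕ) (i : Fin (n + 1)) (hi : i.1 < j) (hj : j ≤ n + 1) {B : Set Y}
    (hB : MeasurableSet B) :
    (Measure.pi fun _ : Fin (n + 1) => P) (winSet n j i B) =
      ∫⁻ z in Prod.fst ⁻¹' B, P {w | w.2 < z.2} ^ i.1 * P {w | w.2 ≤ z.2} ^ (j - 1 - i.1) ∂P := by
  classical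
  set A : Fin (n + 1) → Y × ℝ → Set (Y × ℝ) := fun k z =>
    if k.1 < i.1 then {w | w.2 < z.2} else if k = i then Set.univ else
      if k.1 < j then {w | w.2 ≤ z.2} else Set.univ with hA
  have hmem : ∀ x, x ∈ winSet n j i B ↔ (x i).1 ∈ B ∧ ∀ k : Fin n,
      x (i.succAbove k) ∈ A (i.succAbove k) (x i) := by
    intro x
    have hall : (∀ k, x k ∈ A k (x i)) ↔ ∀ k : Fin n,
      x (i.succAbove k) ∈ A (i.succAbove k) (x i) := by
      rw [i.forall_iff_succAbove]
      simp [hA]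
    rw [← hall, winSet, Set.mem_ofPred_eq]
    refine and_congr_right fun _ => forall_congr' fun k => ?_
    simp only [hA]
    split_ifs with h1 h2 h3
    · simp only [h1, true_imp_iff, Set.mem_ofPred_eq]
      exact ⟨fun h => h.1, fun h => ⟨h, fun _ => h.le⟩⟩
    · subst h2; simp
    · simp [h1, h3]
    · simp [h1, h3]
  set e := MeasurableEquiv.piFinSuccAbove (fun _ : Fin (n + 1) => Y × ℝ) i with he
  have hmp := measurePreserving_piFinSuccAbove (fun _ : Fin (n + 1) => P) i
  have hpre : winSet n j i B = e.symm.symm ⁻¹' (e.symm ⁻¹' winSet n j i B) := by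
    ext x; simp
  have hms : MeasurableSet (e.symm ⁻¹' winSet n j i B) :=
    e.symm.measurable (measurableSet_winSet n j i hB)
  have h1 : (Measure.pi fun _ : Fin (n + 1) => P) (winSet n j i B) =
      (P.prod (Measure.pi fun _ : Fin n => P)) (e.symm ⁻¹' winSet n j i B) := by
    rw [← hmp.measure_preimage hms.nullMeasurableSet, ← he]
    congr 1
  rw [h1, Measure.prod_apply hms, ← lintegral_indicator (measurable_fst hB)]
  refine lintegral_congr fun z => ?_
  have hset : Prod.mk z ⁻¹' (e.symm ⁻¹' winSet n j i B) =
      {y | z.1 ∈ B ∧ y ∈ Set.pi Set.univ fun k => A (i.succAbove k) z} := by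
    ext y
    simp only [Set.mem_preimage, hmem, Set.mem_ofPred_eq, Set.mem_pi, Set.mem_univ, true_imp_iff]
    have hs : e.symm (z, y) = i.insertNth (α := fun _ => Y × ℝ) z y := rfl
    rw [hs]
    simp
  rw [hset]
  by_cases hz : z.1 ∈ B
  · rw [Set.indicator_of_mem (by exact hz)]
    simp only [hz, true_and, Set.ofPred_mem_eq]
    rw [Measure.pi_pi]
    have hprod : ∏ k : Fin (n + 1), P (A k z) = ∏ k : Fin n, P (A (i.succAbove k) z) := by
      rw [Fin.prod_univ_succAbove _ i]
      simp [hA]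
    rw [← hprod]
    set a := P {w | w.2 < z.2}
    set b := P {w | w.2 ≤ z.2}
    have hk : ∀ k : Fin (n + 1), P (A k z) = (fun k : ℕ => if k < i.1 then a else
        if k = i.1 then 1 else if k < j then b else 1) k.1 := by
      intro k
      simp only [hA, Fin.ext_iff]
      split_ifs <;> simp [a, b]
    simp_rw [hk]
    rw [Fin.prod_univ_eq_prod_range (fun k : ℕ => if k < i.1 then a else
        if k = i.1 then 1 else if k < j then b else 1) (n + 1)]
    exact prod_aux n i.1 j hi hj a b
  · rw [Set.indicator_of_notMem (by exact hz)]
    simp [hz]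

lemma pi_ltOutput {Y : Type*} [MeasurableSpace Y] [Nonempty Y] (P : Measure (Y × ℝ))
    [IsProbabilityMeasure P] (n j : ℕ) (hj : j < n + 1) {B : Set Y} (hB : MeasurableSet B) :
    (Measure.pi fun _ : Fin (n + 1) => P) {x | ltOutput (n + 1) (x, j + 1) ∈ B} =
      ∑ i ∈ Finset.range (j + 1), ∫⁻ z in Prod.fst ⁻¹' B,
        P {w | w.2 < z.2} ^ i * P {w | w.2 ≤ z.2} ^ (j - i) ∂P := by
  classical
  have hset : {x : Fin (n + 1) → Y × ℝ | ltOutput (n + 1) (x, j + 1) ∈ B} =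
      ⋃ i ∈ Finset.univ.filter (fun i : Fin (n + 1) => i.1 < j + 1), winSet n (j + 1) i B := by
    ext x
    rw [Set.mem_ofPred_eq, ltOutput_mem_iff n (j + 1) (by omega) (by omega)]
    simp only [Finset.mem_filter, Finset.mem_univ, true_and, Set.mem_iUnion, exists_prop]
  rw [hset, measure_biUnion_finset]
  · set F : ℕ → ENNReal := fun i => ∫⁻ z in Prod.fst ⁻¹' B,
        P {w | w.2 < z.2} ^ i * P {w | w.2 ≤ z.2} ^ (j - i) ∂P with hF
    have h1 : ∑ i ∈ Finset.univ.filter (fun i : Fin (n + 1) => i.1 < j + 1),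
        (Measure.pi fun _ : Fin (n + 1) => P) (winSet n (j + 1) i B) =
        ∑ i ∈ Finset.univ.filter (fun i : Fin (n + 1) => i.1 < j + 1), F i.1 := by
      refine Finset.sum_congr rfl fun i hi => ?_
      rw [pi_winSet P n (j + 1) i (by simpa using hi) (by omega) hB]
      simp [hF]
    rw [h1, Finset.sum_filter,
      Fin.sum_univ_eq_sum_range (fun i => if i < j + 1 then F i else 0) (n + 1),
      ← Finset.sum_filter]
    refine Finset.sum_congr ?_ fun _ _ => rfl
    ext k; simp only [Finset.mem_filter, Finset.mem_range]; omega
  · intro i hi i' hi' hne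
    simp only [Finset.coe_filter, Finset.mem_univ, true_and, Set.mem_ofPred_eq] at hi hi'
    exact winSet_disjoint n (j + 1) B i i' hi hi' hne
  · exact fun i _ => measurableSet_winSet n (j + 1) i hB

lemma ltMechanism_apply {X Y : Type*} [MeasurableSpace Y] [Nonempty Y]
    (γ : ℝ) (n : ℕ) (Q : Multiset X → Measure (Y × ℝ)) (D : Multiset X)
    [IsProbabilityMeasure (Q D)] {B : Set Y} (hB : MeasurableSet B) :
    ltMechanism γ (n + 1) Q D B = ∑ j ∈ Finset.range (n + 1),
      ENNReal.ofReal (if j < n then γ * (1 - γ) ^ j else (1 - γ) ^ n) *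
      (Measure.pi fun _ : Fin (n + 1) => Q D) {x | ltOutput (n + 1) (x, j + 1) ∈ B} := by
  have him : Finset.Icc 1 (n + 1) = (Finset.range (n + 1)).image (fun j => j + 1) := by
    ext k
    simp only [Finset.mem_Icc, Finset.mem_image, Finset.mem_range]
    constructor
    · intro h; exact ⟨k - 1, by omega, by omega⟩
    · rintro ⟨a, h, rfl⟩; omega
  have hst : stopLaw γ (n + 1) = ∑ j ∈ Finset.range (n + 1),
      (ENNReal.ofReal (if j < n then γ * (1 - γ) ^ j else (1 - γ) ^ n)) •
        Measure.dirac (j + 1) := by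
    unfold stopLaw
    rw [him, Finset.sum_image (by intro a _ b _ h; simpa using h)]
    simp
  haveI : IsFiniteMeasure (stopLaw γ (n + 1)) := by
    constructor
    rw [hst]
    simp
  have hm := measurable_ltOutput (Y := Y) n
  rw [ltMechanism, Measure.map_apply hm hB, Measure.prod_apply_symm (hm hB), hst,
    lintegral_finsetSum_measure]
  refine Finset.sum_congr rfl fun j _ => ?_
  rw [lintegral_smul_measure, lintegral_dirac]
  rfl

lemma sum_eq_lintegral {Y : Type*} [MeasurableSpace Y] [Nonempty Y] (P : Measure (Y × ℝ))
    [IsProbabilityMeasure P] (γ : ℝ) (hγ : γ ∈ Set.Ioc (0 : ℝ) 1) (n : ℕ) {B : Set Y}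
    (hB : MeasurableSet B) :
    ∑ j ∈ Finset.range (n + 1), ENNReal.ofReal (γ * (1 - γ) ^ j) *
      (Measure.pi fun _ : Fin (n + 1) => P) {x | ltOutput (n + 1) (x, j + 1) ∈ B} =
    ∫⁻ z in Prod.fst ⁻¹' B, ENNReal.ofReal (γ * gSer (n + 1)
      ((1 - γ) * P.real {w | w.2 < z.2}) ((1 - γ) * P.real {w | w.2 ≤ z.2})) ∂P := by
  have hγ1 : 0 ≤ 1 - γ := by linarith [hγ.2]
  have hγ0 := hγ.1
  have hma : Measurable fun z : Y × ℝ => P {w | w.2 < z.2} := by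
    have : Monotone fun t : ℝ => P {w : Y × ℝ | w.2 < t} := fun s t hst =>
      measure_mono fun w (hw : w.2 < s) => lt_of_lt_of_le hw hst
    exact this.measurable.comp measurable_snd
  have hmb : Measurable fun z : Y × ℝ => P {w | w.2 ≤ z.2} := by
    have : Monotone fun t : ℝ => P {w : Y × ℝ | w.2 ≤ t} := fun s t hst =>
      measure_mono fun w (hw : w.2 ≤ s) => le_trans hw hst
    exact this.measurable.comp measurable_snd
  have h1 : ∀ z : Y × ℝ, ENNReal.ofReal (γ * gSer (n + 1)
      ((1 - γ) * P.real {w | w.2 < z.2}) ((1 - γ) * P.real {w | w.2 ≤ z.2})) =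
      ∑ j ∈ Finset.range (n + 1), ENNReal.ofReal (γ * (1 - γ) ^ j) *
        ∑ i ∈ Finset.range (j + 1), P {w | w.2 < z.2} ^ i * P {w | w.2 ≤ z.2} ^ (j - i) := by
    intro z
    rw [gSer, Finset.mul_sum, ENNReal.ofReal_sum_of_nonneg (fun j _ => by positivity)]
    refine Finset.sum_congr rfl fun j _ => ?_
    have h2 : γ * ∑ i ∈ Finset.range (j + 1), ((1 - γ) * P.real {w | w.2 < z.2}) ^ i *
        ((1 - γ) * P.real {w | w.2 ≤ z.2}) ^ (j - i) = (γ * (1 - γ) ^ j) *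
        ∑ i ∈ Finset.range (j + 1), P.real {w | w.2 < z.2} ^ i *
          P.real {w | w.2 ≤ z.2} ^ (j - i) := by
      rw [Finset.mul_sum, Finset.mul_sum]
      refine Finset.sum_congr rfl fun i hi => ?_
      have hij : i ≤ j := by simpa [Nat.lt_succ_iff] using hi
      have h3 : (1 - γ) ^ j = (1 - γ) ^ i * (1 - γ) ^ (j - i) := by
        rw [← pow_add, Nat.add_sub_cancel' hij]
      rw [h3, mul_pow, mul_pow]; ring
    rw [h2, ENNReal.ofReal_mul (by positivity),
      ENNReal.ofReal_sum_of_nonneg (fun i _ => by positivity)]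
    congr 1
    refine Finset.sum_congr rfl fun i _ => ?_
    rw [ENNReal.ofReal_mul (by positivity), ENNReal.ofReal_pow (by positivity),
      ENNReal.ofReal_pow (by positivity), ofReal_measureReal, ofReal_measureReal]
  have hterm : ∀ i k : ℕ, Measurable fun z : Y × ℝ =>
      P {w | w.2 < z.2} ^ i * P {w | w.2 ≤ z.2} ^ k := fun i k =>
    (hma.pow_const i).mul (hmb.pow_const k)
  have hsum : ∀ j : ℕ, Measurable fun z : Y × ℝ => ∑ i ∈ Finset.range (j + 1),
      P {w | w.2 < z.2} ^ i * P {w | w.2 ≤ z.2} ^ (j - i) := fun j =>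
    Finset.measurable_fun_sum _ fun i _ => hterm i (j - i)
  simp_rw [h1]
  rw [lintegral_finsetSum _ (fun j _ => (hsum j).const_mul _)]
  refine Finset.sum_congr rfl fun j hj => ?_
  rw [lintegral_const_mul _ (hsum j), lintegral_finsetSum _ (fun i _ => hterm i (j - i)),
    pi_ltOutput P n j (Finset.mem_range.1 hj) hB]

lemma core {Y : Type*} [MeasurableSpace Y] (P P' : Measure (Y × ℝ))
    [IsProbabilityMeasure P] [IsProbabilityMeasure P'] (γ ε δ η : ℝ)
    (hγ : γ ∈ Set.Ioc (0 : ℝ) 1) (hε : 0 ≤ ε) (hδ : 0 ≤ δ) (hη : 0 ≤ η)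
    (hηγ : η ≤ γ) (hδη : η ^ 2 = 2 * δ) (T : ℕ)
    (h : ∀ A, MeasurableSet A → P A ≤ ENNReal.ofReal (Real.exp ε) * P' A + ENNReal.ofReal δ)
    (h' : ∀ A, MeasurableSet A → P' A ≤ ENNReal.ofReal (Real.exp ε) * P A + ENNReal.ofReal δ)
    {B : Set Y} (hB : MeasurableSet B) :
    ∫⁻ z in Prod.fst ⁻¹' B, ENNReal.ofReal (γ * gSer T
      ((1 - γ) * P.real {w | w.2 < z.2}) ((1 - γ) * P.real {w | w.2 ≤ z.2})) ∂P ≤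
    ENNReal.ofReal (Real.exp (3 * ε + 3 * η)) * ∫⁻ z in Prod.fst ⁻¹' B, ENNReal.ofReal (γ * gSer T
      ((1 - γ) * P'.real {w | w.2 < z.2}) ((1 - γ) * P'.real {w | w.2 ≤ z.2})) ∂P' +
      ENNReal.ofReal (η * T) := by
  obtain ⟨hγ0, hγ1⟩ := hγ
  have hg1 : 0 ≤ 1 - γ := by linarith
  have hma : ∀ R : Measure (Y × ℝ), [IsProbabilityMeasure R] →
      Measurable fun z : Y × ℝ => R.real {w | w.2 < z.2} := by
    intro R _
    have : Monotone fun t : ℝ => R.real {w : Y × ℝ | w.2 < t} := fun s t hst =>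
      measureReal_mono fun w (hw : w.2 < s) => lt_of_lt_of_le hw hst
    exact this.measurable.comp measurable_snd
  have hmb : ∀ R : Measure (Y × ℝ), [IsProbabilityMeasure R] →
      Measurable fun z : Y × ℝ => R.real {w | w.2 ≤ z.2} := by
    intro R _
    have : Monotone fun t : ℝ => R.real {w : Y × ℝ | w.2 ≤ t} := fun s t hst =>
      measureReal_mono fun w (hw : w.2 ≤ s) => le_trans hw hst
    exact this.measurable.comp measurable_snd
  have hmG : ∀ R : Measure (Y × ℝ), [IsProbabilityMeasure R] → Measurable fun z : Y × ℝ =>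
      γ * gSer T ((1 - γ) * R.real {w | w.2 < z.2}) ((1 - γ) * R.real {w | w.2 ≤ z.2}) := by
    intro R _
    have := hma R
    have := hmb R
    unfold gSer
    fun_prop
  set c := Real.exp (ε + η) with hc
  have hexp : Real.exp ε * (1 + η) ≤ c := by
    rw [hc, Real.exp_add]
    have := Real.add_one_le_exp η
    gcongr; linarith
  have he1 : 1 ≤ Real.exp ε := Real.one_le_exp hε
  have hc1 : 1 ≤ c := Real.one_le_exp (by linarith)
  -- ratio of tail terms
  have hratio : ∀ A, MeasurableSet A → 1 - (1 - γ) * P'.real A ≤ c * (1 - (1 - γ) * P.real A) := by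
    intro A hA
    have h1 := h' Aᶜ hA.compl
    have h2 : P'.real Aᶜ ≤ Real.exp ε * P.real Aᶜ + δ := by
      rw [measureReal_def, measureReal_def]
      have := ENNReal.toReal_mono (by finiteness) h1
      rw [ENNReal.toReal_add (by finiteness) (by finiteness), ENNReal.toReal_mul,
        ENNReal.toReal_ofReal (Real.exp_pos _).le, ENNReal.toReal_ofReal hδ] at this
      exact this
    rw [probReal_compl_eq_one_sub hA, probReal_compl_eq_one_sub hA] at h2
    set a := P.real A
    set a' := P'.real A
    have ha : a ≤ 1 := measureReal_le_one
    have h3 := mul_le_mul_of_nonneg_left h2 hg1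
    have h4 : γ ≤ 1 - (1 - γ) * a := by nlinarith
    have h5 : Real.exp ε * (1 + η) * (1 - (1 - γ) * a) ≤ c * (1 - (1 - γ) * a) :=
      mul_le_mul_of_nonneg_right hexp (by linarith)
    have h6 : η * γ ≤ Real.exp ε * η * (1 - (1 - γ) * a) := by
      have : 1 * η * γ ≤ Real.exp ε * η * (1 - (1 - γ) * a) := by gcongr
      linarith
    have h7 : δ ≤ η * γ := by nlinarith
    have h8 : (1 - γ) * δ ≤ δ := by nlinarith
    have h9 : γ ≤ Real.exp ε * γ := by nlinarith
    nlinarith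
  have hlt : ∀ z : Y × ℝ, MeasurableSet {w : Y × ℝ | w.2 < z.2} := fun z =>
    measurableSet_lt measurable_snd measurable_const
  have hle : ∀ z : Y × ℝ, MeasurableSet {w : Y × ℝ | w.2 ≤ z.2} := fun z =>
    measurableSet_le measurable_snd measurable_const
  have hpt : ∀ z : Y × ℝ, γ * gSer T
      ((1 - γ) * P.real {w | w.2 < z.2}) ((1 - γ) * P.real {w | w.2 ≤ z.2}) ≤
      c * c * (γ * gSer T
      ((1 - γ) * P'.real {w | w.2 < z.2}) ((1 - γ) * P'.real {w | w.2 ≤ z.2})) := by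
    intro z
    have hle1 : ∀ A, (1 - γ) * P.real A ≤ 1 - γ := fun A =>
      mul_le_of_le_one_right hg1 measureReal_le_one
    have := gSer_ratio2 T (u := (1 - γ) * P.real {w | w.2 < z.2})
      (u' := (1 - γ) * P'.real {w | w.2 < z.2}) (v := (1 - γ) * P.real {w | w.2 ≤ z.2})
      (v' := (1 - γ) * P'.real {w | w.2 ≤ z.2}) (c := c) (by positivity) (by positivity)
      (by positivity) (by positivity) (by linarith [hle1 {w | w.2 < z.2}])
      (by linarith [hle1 {w | w.2 ≤ z.2}]) hc1 (hratio _ (hlt z)) (hratio _ (hle z))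
    have := mul_le_mul_of_nonneg_left this hγ0.le
    linarith
  have hBm : MeasurableSet (Prod.fst ⁻¹' B : Set (Y × ℝ)) := measurable_fst hB
  have hdp := dp_lintegral (P.restrict (Prod.fst ⁻¹' B)) (P'.restrict (Prod.fst ⁻¹' B))
    (ENNReal.ofReal (Real.exp ε)) (ENNReal.ofReal δ)
    (fun A hA => by
      rw [Measure.restrict_apply hA, Measure.restrict_apply hA]
      exact h _ (hA.inter hBm)) T _ (hmG P)
    (fun z => mul_nonneg hγ0.le (gSer_nonneg T (by positivity) (by positivity)))
    (fun z => gSer_bound T ⟨hγ0, hγ1⟩ (by positivity) (by positivity)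
      (mul_le_of_le_one_right hg1 measureReal_le_one)
      (mul_le_of_le_one_right hg1 measureReal_le_one))
  refine hdp.trans (add_le_add ?_ ?_)
  · calc _ ≤ ENNReal.ofReal (Real.exp ε) * ∫⁻ z in Prod.fst ⁻¹' B, ENNReal.ofReal (c * c) *
        ENNReal.ofReal (γ * gSer T
        ((1 - γ) * P'.real {w | w.2 < z.2}) ((1 - γ) * P'.real {w | w.2 ≤ z.2})) ∂P' := by
          gcongr with z
          rw [← ENNReal.ofReal_mul (by positivity)]
          exact ENNReal.ofReal_le_ofReal (hpt z)
      _ = ENNReal.ofReal (Real.exp ε * (c * c)) * ∫⁻ z in Prod.fst ⁻¹' B,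
        ENNReal.ofReal (γ * gSer T
        ((1 - γ) * P'.real {w | w.2 < z.2}) ((1 - γ) * P'.real {w | w.2 ≤ z.2})) ∂P' := by
          rw [lintegral_const_mul _ (hmG P').ennreal_ofReal, ← mul_assoc,
            ← ENNReal.ofReal_mul (Real.exp_pos _).le]
      _ ≤ _ := by
          gcongr
          rw [hc, ← Real.exp_add, ← Real.exp_add]
          exact Real.exp_le_exp.2 (by linarith)
  · rw [← ENNReal.ofReal_mul hδ]
    refine ENNReal.ofReal_le_ofReal ?_
    gcongr
    nlinarith

/-- Theorem 1 of the paper (Liu–Talwar): if the base candidate-and-score mechanism `Q` is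
`(ε₁, δ₁)`-differentially private, then the LT random-stopping selection mechanism with
stopping probability `γ` and cap `Υ = ⌈(1/γ)log(1/δ₂)⌉` is `(ε_f, δ_f)`-differentially
private for `ε_f = 3ε₁ + 3√(2δ₁)` and `δ_f = √(2δ₁)·Υ + δ₂`. -/
theorem stmt8 {X Y : Type*} [MeasurableSpace Y] [Nonempty Y]
    (γ δ₂ ε₁ δ₁ : ℝ) (hγ : γ ∈ Set.Ioc (0 : ℝ) 1) (hδ₂ : 0 < δ₂)
    (hε₁ : 0 ≤ ε₁) (hδ₁ : 0 ≤ δ₁)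
    (Υ : ℕ) (hΥ : Υ = ⌈(1 / γ) * Real.log (1 / δ₂)⌉₊)
    (Q : Multiset X → Measure (Y × ℝ))
    (hQprob : ∀ D, IsProbabilityMeasure (Q D))
    (hQdp : ∀ D D' : Multiset X, Adjacent D D' → ∀ A : Set (Y × ℝ), MeasurableSet A →
      Q D A ≤ ENNReal.ofReal (Real.exp ε₁) * Q D' A + ENNReal.ofReal δ₁)
    (εf δf : ℝ)
    (hεf : εf = 3 * ε₁ + 3 * Real.sqrt (2 * δ₁))
    (hδf : δf = Real.sqrt (2 * δ₁) * Υ + δ₂) :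
    ∀ D D' : Multiset X, Adjacent D D' → ∀ B : Set Y, MeasurableSet B →
      ltMechanism γ Υ Q D B ≤ ENNReal.ofReal (Real.exp εf) * ltMechanism γ Υ Q D' B + ENNReal.ofReal δf := by
  intro D D' hadj B hB
  haveI := hQprob D
  haveI := hQprob D'
  have hadj' : Adjacent D' D := by
    obtain ⟨a, b, D₀, h1, h2⟩ := hadj
    exact ⟨b, a, D₀, h2, h1⟩
  set η := Real.sqrt (2 * δ₁) with hη
  have hη0 : 0 ≤ η := Real.sqrt_nonneg _
  have hη2 : η ^ 2 = 2 * δ₁ := Real.sq_sqrt (by linarith)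
  obtain ⟨hγ0, hγ1⟩ := hγ
  have hg1 : 0 ≤ 1 - γ := by linarith
  rcases Nat.eq_zero_or_pos Υ with h0 | hpos
  · subst h0
    have : ltMechanism γ 0 Q D = 0 := by
      simp [ltMechanism, stopLaw]
    rw [this]; simp
  obtain ⟨n, rfl⟩ : ∃ n, Υ = n + 1 := ⟨Υ - 1, by omega⟩
  have hpi : ∀ j, (Measure.pi fun _ : Fin (n + 1) => Q D)
      {x | ltOutput (n + 1) (x, j + 1) ∈ B} ≤ 1 := fun j => prob_le_one
  have hsplit : ltMechanism γ (n + 1) Q D B ≤ (∑ j ∈ Finset.range (n + 1),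
      ENNReal.ofReal (γ * (1 - γ) ^ j) * (Measure.pi fun _ : Fin (n + 1) => Q D)
        {x | ltOutput (n + 1) (x, j + 1) ∈ B}) + ENNReal.ofReal ((1 - γ) ^ (n + 1)) := by
    rw [ltMechanism_apply γ n Q D hB, Finset.sum_range_succ, Finset.sum_range_succ, add_assoc]
    refine add_le_add (Finset.sum_le_sum fun j hj => ?_) ?_
    · rw [if_pos (Finset.mem_range.1 hj)]
    · rw [if_neg (lt_irrefl n)]
      have : (1 - γ) ^ n = γ * (1 - γ) ^ n + (1 - γ) ^ (n + 1) := by ring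
      nth_rewrite 1 [this]
      rw [ENNReal.ofReal_add (by positivity) (by positivity), add_mul]
      gcongr
      exact mul_le_of_le_one_right' (hpi n)
  have hlow : (∑ j ∈ Finset.range (n + 1),
      ENNReal.ofReal (γ * (1 - γ) ^ j) * (Measure.pi fun _ : Fin (n + 1) => Q D')
        {x | ltOutput (n + 1) (x, j + 1) ∈ B}) ≤ ltMechanism γ (n + 1) Q D' B := by
    rw [ltMechanism_apply γ n Q D' hB]
    refine Finset.sum_le_sum fun j hj => ?_
    gcongr
    split_ifs with h
    · exact le_rfl
    · have : j = n := by have := Finset.mem_range.1 hj; omega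
      rw [this]
      exact mul_le_of_le_one_left (by positivity) hγ1
  rw [sum_eq_lintegral (Q D) γ ⟨hγ0, hγ1⟩ n hB] at hsplit
  rw [sum_eq_lintegral (Q D') γ ⟨hγ0, hγ1⟩ n hB] at hlow
  by_cases hbig : 1 ≤ δf
  · have hle1 : ltMechanism γ (n + 1) Q D B ≤ 1 := by
      rw [ltMechanism_apply γ n Q D hB]
      calc _ ≤ ∑ j ∈ Finset.range (n + 1),
            ENNReal.ofReal (if j < n then γ * (1 - γ) ^ j else (1 - γ) ^ n) := by
              refine Finset.sum_le_sum fun j _ => mul_le_of_le_one_right' (hpi j)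
        _ = ENNReal.ofReal (∑ j ∈ Finset.range (n + 1),
            (if j < n then γ * (1 - γ) ^ j else (1 - γ) ^ n)) := by
              rw [ENNReal.ofReal_sum_of_nonneg]
              intro j _; split_ifs <;> positivity
        _ = 1 := by
              rw [Finset.sum_range_succ, if_neg (lt_irrefl n),
                Finset.sum_congr rfl (g := fun j => γ * (1 - γ) ^ j)
                  fun j hj => if_pos (Finset.mem_range.1 hj), ← Finset.mul_sum]
              have := mul_neg_geom_sum (1 - γ) n
              rw [sub_sub_cancel] at this
              rw [this]; simp
        _ ≤ 1 := le_rfl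
    refine hle1.trans (le_trans ?_ le_add_self)
    rw [← ENNReal.ofReal_one]
    exact ENNReal.ofReal_le_ofReal hbig
  · push Not at hbig
    have hΥr : (1 / γ) * Real.log (1 / δ₂) ≤ ((n + 1 : ℕ) : ℝ) := by
      rw [hΥ]; exact Nat.le_ceil _
    have hlog : Real.log (1 / δ₂) ≤ γ * ((n + 1 : ℕ) : ℝ) := by
      have := mul_le_mul_of_nonneg_left hΥr hγ0.le
      rwa [← mul_assoc, mul_one_div_cancel hγ0.ne', one_mul] at this
    have hlog2 : Real.log (1 / δ₂) = - Real.log δ₂ := by rw [one_div, Real.log_inv]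
    have hηT : 0 ≤ η * ((n + 1 : ℕ) : ℝ) := by positivity
    have hδ21 : δ₂ < 1 := by linarith
    have hηγ : η ≤ γ := by
      have h1 := Real.log_le_sub_one_of_pos hδ₂
      have h2 : 1 - δ₂ ≤ γ * ((n + 1 : ℕ) : ℝ) := by linarith
      have h3 := mul_le_mul_of_nonneg_left h2 hη0
      by_contra hcon
      push Not at hcon
      have : γ * (η * ((n + 1 : ℕ) : ℝ)) ≤ γ * (1 - δ₂) := by
        gcongr; linarith
      nlinarith
    have hpow : (1 - γ) ^ (n + 1) ≤ δ₂ := by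
      calc (1 - γ) ^ (n + 1) ≤ Real.exp (-γ) ^ (n + 1) := by
            gcongr; exact Real.one_sub_le_exp_neg γ
        _ = Real.exp (-(γ * ((n + 1 : ℕ) : ℝ))) := by
            rw [← Real.exp_nat_mul]; congr 1; ring
        _ ≤ Real.exp (Real.log δ₂) := Real.exp_le_exp.2 (by linarith)
        _ = δ₂ := Real.exp_log hδ₂
    have hcore := core (Q D) (Q D') γ ε₁ δ₁ η ⟨hγ0, hγ1⟩ hε₁ hδ₁ hη0 hηγ hη2 (n + 1)
      (hQdp D D' hadj) (hQdp D' D hadj') hB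
    rw [hεf, hδf, ENNReal.ofReal_add hηT hδ₂.le, ← add_assoc]
    refine hsplit.trans (add_le_add (hcore.trans ?_) (ENNReal.ofReal_le_ofReal hpow))
    gcongr
end
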